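/- Let γ = 5/2 − √2 + (1/2)√(29 − 20√2) and η = 1/γ = 5/2 − √2 − (1/2)√(29 − 20√2). For all ρ ∈ (0,1] and θ ∈ (π/4, π/2), the quantity f(ρ,θ) := (η sin²θ − 1) ρ² − (2η sin²θ − √2 (sin θ + cos θ)) ρ − (√2 cos θ − 3/2) η − 1 is strictly negative. -/

import Mathlib

open Real

/-- The number `η` lies in a small interval and is a root of `η² - (5 - 2√2) η + 1`. -/
lemma eta_bounds_and_quadratic {η : ℝ} (hη : η = 5/2 - √2 - (1/2) * √(29 - 20 * √2)) :
    0.6626 < η ∧ η < 0.6629 ∧ η ^ 2 = (5 - 2 * √2) * η - 1 := by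
  have h2 : √2 ^ 2 = 2 := Real.sq_sqrt (by norm_num)
  have hl : 1.41421 < √2 := Real.lt_sqrt_of_sq_lt (by norm_num)
  have hu : √2 < 1.41422 := (Real.sqrt_lt' (by norm_num)).2 (by norm_num)
  have hr : √(29 - 20 * √2) ^ 2 = 29 - 20 * √2 := Real.sq_sqrt (by linarith)
  have hrl : 0.8459 < √(29 - 20 * √2) := Real.lt_sqrt_of_sq_lt (by linarith)
  have hru : √(29 - 20 * √2) < 0.8461 := (Real.sqrt_lt' (by norm_num)).2 (by linarith)
  refine ⟨by linarith, by linarith, ?_⟩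
  subst hη
  linear_combination (1/4) * hr - h2

/-- A quadratic polynomial with negative leading coefficient and negative discriminant is
negative. -/
lemma quadratic_neg_of_discrim_neg {a b c : ℝ} (ha : a < 0) (h : discrim a b c < 0) (t : ℝ) :
    a * t ^ 2 + b * t + c < 0 := by
  rw [discrim] at h
  nlinarith [sq_nonneg (2 * a * t + b)]

/-- The discriminant in `ρ`, in terms of `x = √2 cos θ` and `y = √2 sin θ`. -/
lemma discriminant_neg {η x y : ℝ} (hl : 0.6626 < η) (hu : η < 0.6629)
    (hη : η ^ 2 = (5 - 2 * √2) * η - 1) (hx0 : 0 < x) (hx1 : x < 1) (hy : 0 < y)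
    (hxy : x ^ 2 + y ^ 2 = 2) :
    (η * y ^ 2 - (x + y)) ^ 2 - 4 * (1 - η * y ^ 2 / 2) * (1 + η * x - 3 / 2 * η) < 0 := by
  have h2 : √2 ^ 2 = 2 := Real.sq_sqrt (by norm_num)
  have hsl : 1.41421 < √2 := Real.lt_sqrt_of_sq_lt (by norm_num)
  have hsu : √2 < 1.41422 := (Real.sqrt_lt' (by norm_num)).2 (by norm_num)
  have hy2 : y ^ 2 = 2 - x ^ 2 := by linarith
  have hlin : (η * y ^ 2 - (x + y)) ^ 2 - 4 * (1 - η * y ^ 2 / 2) * (1 + η * x - 3 / 2 * η) =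
      (η * (2 - x ^ 2)) ^ 2 - 2 * (η * (2 - x ^ 2)) * x + 2
        - 4 * (1 - η * (2 - x ^ 2) / 2) * (1 + η * x - 3 / 2 * η)
        + 2 * (x - η * (2 - x ^ 2)) * y := by
    rw [hy2]
    linear_combination hxy
  rw [hlin]
  rcases le_total 0 (x - η * (2 - x ^ 2)) with hQ | hQ
  · have hyu : y ≤ 2 - x := by nlinarith [sq_nonneg (1 - x)]
    have hmul := mul_le_mul_of_nonneg_left hyu hQ
    have hpos : 0 < (1 - x) ^ 2 * (2 - 2 * η + η * (η * (2 - x ^ 2))) := by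
      have : 0 < 2 - x ^ 2 := by nlinarith
      have : 0 < 1 - x := by linarith
      have : 0 < η := by linarith
      have : 0 < η * (η * (2 - x ^ 2)) := by positivity
      exact mul_pos (by positivity) (by linarith)
    linarith
  · have hyl : √2 - (√2 - 1) * x ^ 2 ≤ y := by
      have hyle : 1 < y := by nlinarith only [hx0, hx1, hy, hy2]
      have hfac : (√2 - y) * (√2 + y) = x ^ 2 := by linear_combination h2 - hy2
      have hys : y ≤ √2 := Real.le_sqrt_of_sq_le (by linarith [sq_nonneg x])
      have hprod : (√2 - y) * (√2 + 1) ≤ x ^ 2 := by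
        rw [← hfac]
        exact mul_le_mul_of_nonneg_left (by linarith) (by linarith)
      have hmul := mul_le_mul_of_nonneg_right hprod (show 0 ≤ √2 - 1 by linarith)
      linear_combination hmul + (y - √2) * h2
    have hmul := mul_le_mul_of_nonpos_left hyl hQ
    have hc : 2 * √2 - 8 * η + 4 * η ^ 2
        + (2 * √2 - 8 * η + 4 * η ^ 2 + η * (6 * √2 - 6 - η)) * x
        - (η ^ 2 - 2 * η * (√2 - 1)) * x ^ 2 < 0 := by
      have h1 : 2 * √2 - 8 * η + 4 * η ^ 2 < -0.71 := by nlinarith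
      have h3 : 2 * √2 - 8 * η + 4 * η ^ 2 + η * (6 * √2 - 6 - η) < 0.5 := by nlinarith
      have h4 : -(η ^ 2 - 2 * η * (√2 - 1)) < 0.12 := by nlinarith
      nlinarith only [h1, h3, h4, hx0, hx1,
        mul_lt_mul_of_pos_right h3 hx0, mul_lt_mul_of_pos_right h4 (sq_pos_of_pos hx0)]
    have hneg := mul_neg_of_pos_of_neg (mul_pos hx0 (sub_pos.2 hx1)) hc
    linear_combination hneg + 2 * hmul + (2 * x ^ 3 - 2) * hη

/-- With η = 5/2 − √2 − (1/2)√(29 − 20√2), for all ρ ∈ (0,1] and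
θ ∈ (π/4, π/2), one has
(η sin²θ − 1)ρ² − (2η sin²θ − √2(sin θ + cos θ))ρ − (√2 cos θ − 3/2)η − 1 < 0. -/
theorem stmt10 (ρ θ : ℝ) (hρ : ρ ∈ Set.Ioc (0:ℝ) 1) (hθ : θ ∈ Set.Ioo (π/4) (π/2)) :
    let η : ℝ := 5/2 - Real.sqrt 2 - (1/2) * Real.sqrt (29 - 20 * Real.sqrt 2)
    (η * sin θ ^ 2 - 1) * ρ ^ 2
      - (2 * η * sin θ ^ 2 - Real.sqrt 2 * (sin θ + cos θ)) * ρ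
      - (Real.sqrt 2 * cos θ - 3/2) * η - 1 < 0 := by
  intro η
  obtain ⟨hl, hu, hη⟩ := eta_bounds_and_quadratic (η := η) rfl
  have h2 : √2 ^ 2 = 2 := Real.sq_sqrt (by norm_num)
  have hs : 0 < √2 := by positivity
  have hsc : sin θ ^ 2 + cos θ ^ 2 = 1 := sin_sq_add_cos_sq θ
  have hsin : 0 < sin θ :=
    sin_pos_of_pos_of_lt_pi (by linarith [hθ.1, pi_pos]) (by linarith [hθ.2, pi_pos])
  have hcos : 0 < cos θ := cos_pos_of_mem_Ioo ⟨by linarith [hθ.1, pi_pos], hθ.2⟩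
  have hcos_lt : cos θ < √2 / 2 := by
    rw [← cos_pi_div_four]
    exact cos_lt_cos_of_nonneg_of_le_pi (by positivity) (by linarith [hθ.2, pi_pos]) hθ.1
  have hdisc := discriminant_neg hl hu hη (x := √2 * cos θ) (y := √2 * sin θ) (by positivity)
    (by nlinarith) (by positivity) (by linear_combination 2 * hsc + (sin θ ^ 2 + cos θ ^ 2) * h2)
  have hy2 : (√2 * sin θ) ^ 2 = 2 * sin θ ^ 2 := by rw [mul_pow, h2]
  rw [hy2] at hdisc
  have hneg := quadratic_neg_of_discrim_neg (a := η * sin θ ^ 2 - 1)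
    (b := -(2 * η * sin θ ^ 2 - √2 * (sin θ + cos θ)))
    (c := -(√2 * cos θ - 3/2) * η - 1) (by nlinarith [sq_nonneg (cos θ)])
    (by rw [discrim]; linarith) ρ
  linarith
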